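/- arXiv:2407.01966 — 4 statements merged into one kernel-verified Lean document; each statement's English description precedes it below -/
import Mathlib

section
/- Let T be a finite tree, let S be a subset of its vertices of cardinality m ≥ 2, and let F be an (S,*)-rooted spanning forest of T with floating component F_*. Then Σ_A Σ_{(σ,f) ∈ C_S(A)} sgn(σ) = (-1)^m · 2^{m-2} · (bdeg(F_*) − 1) · (bdeg(F_*) − 4), where the outer sum is over all m-arrowflows A on T that are composite for S and have missing forest M(A) = F. -/
open scoped Classical

/-- `H` is an `S`-rooted spanning forest of `G`: an acyclic spanning subgraph in which
distinct vertices of `S` lie in distinct connected components and every vertex is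
reachable from some vertex of `S` (so there are exactly `|S|` components, each
containing exactly one vertex of `S`). -/
def IsSRootedForest {V : Type*} (G H : SimpleGraph V) (S : Finset V) : Prop :=
  H ≤ G ∧ H.IsAcyclic ∧
    (∀ s ∈ S, ∀ t ∈ S, H.Reachable s t → s = t) ∧
    (∀ v : V, ∃ s ∈ S, H.Reachable s v)

/-- The set of vertices not reachable from `S` in `H`; for an `(S,*)`-rooted forest
this is the vertex set of the floating component. -/
def floatSet {V : Type*} (H : SimpleGraph V) (S : Finset V) : Set V :=
  {v | ∀ s ∈ S, ¬ H.Reachable s v}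

/-- `H` is an `(S,*)`-rooted spanning forest of `G`: an acyclic spanning subgraph with
distinct vertices of `S` in distinct components, and whose vertices not reachable from
`S` form a single nonempty connected component (the floating component). -/
def IsSStarRootedForest {V : Type*} (G H : SimpleGraph V) (S : Finset V) : Prop :=
  H ≤ G ∧ H.IsAcyclic ∧
    (∀ s ∈ S, ∀ t ∈ S, H.Reachable s t → s = t) ∧
    (floatSet H S).Nonempty ∧
    (∀ v ∈ floatSet H S, ∀ w ∈ floatSet H S, H.Reachable v w)

/-- The boundary degree of the floating component of `H`: the number of vertices not in
the floating component that are adjacent in `G` to some vertex of the floating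
component. -/
noncomputable def bdeg {V : Type*} (G H : SimpleGraph V) (S : Finset V) : ℕ :=
  Set.ncard {v | v ∉ floatSet H S ∧ ∃ w ∈ floatSet H S, G.Adj v w}

/-- An `m`-arrowflow on `G`: a multiset of `m` ordered pairs, each supported on an
edge of `G`. -/
def IsArrowflow {V : Type*} (G : SimpleGraph V) (m : ℕ) (A : Multiset (V × V)) : Prop :=
  Multiset.card A = m ∧ ∀ p ∈ A, G.Adj p.1 p.2

/-- The underlying simple graph of an arrowflow: `u ~ v` iff `(u,v)` or `(v,u)` is an
arc of `A`. -/
def arrowSG {V : Type*} (A : Multiset (V × V)) : SimpleGraph V :=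
  SimpleGraph.fromRel (fun u v => (u, v) ∈ A)

/-- The missing forest of an arrowflow `A` on `G`: the spanning subgraph of `G` whose
edges are the edges of `G` not underlying any arc of `A`. -/
def missingForest {V : Type*} (G : SimpleGraph V) (A : Multiset (V × V)) : SimpleGraph V :=
  G \ arrowSG A

/-- `A` has parallel arrows: some ordered pair occurs with multiplicity at least 2. -/
def HasParallelArrows {V : Type*} (A : Multiset (V × V)) : Prop :=
  ∃ p : V × V, 2 ≤ A.count p

/-- `A` has a missing path for `S`: two distinct vertices of `S` lie in the same
connected component of the missing forest. -/
def HasMissingPath {V : Type*} (G : SimpleGraph V) (S : Finset V) (A : Multiset (V × V)) : Prop :=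
  ∃ i ∈ S, ∃ j ∈ S, i ≠ j ∧ (missingForest G A).Reachable i j

/-- `A` is zero-sum for `S`. -/
def IsZeroSum {V : Type*} (G : SimpleGraph V) (S : Finset V) (A : Multiset (V × V)) : Prop :=
  HasParallelArrows A ∨ HasMissingPath G S A

/-- `A` is unital for `S`: no parallel arrows, and the missing forest is `S`-rooted. -/
def IsUnital {V : Type*} (G : SimpleGraph V) (S : Finset V) (A : Multiset (V × V)) : Prop :=
  ¬ HasParallelArrows A ∧ IsSRootedForest G (missingForest G A) S

/-- `A` is composite for `S`: no parallel arrows, and the missing forest is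
`(S,*)`-rooted. -/
def IsComposite {V : Type*} (G : SimpleGraph V) (S : Finset V) (A : Multiset (V × V)) : Prop :=
  ¬ HasParallelArrows A ∧ IsSStarRootedForest G (missingForest G A) S

/-- `(σ, f)` is an `S`-catalyst for `G`: `σ` is a permutation of `S` and, for each
`i ∈ S`, `f i = (u, v)` is an oriented edge of `G` lying on the path from `i` to
`σ i`, oriented along it. -/
def IsCatalyst {V : Type*} [Fintype V] (G : SimpleGraph V) (S : Finset V)
    (σ : Equiv.Perm {x // x ∈ S}) (f : {x // x ∈ S} → V × V) : Prop :=
  ∀ i : {x // x ∈ S}, G.Adj (f i).1 (f i).2 ∧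
    G.dist i.val (f i).1 + 1 + G.dist (f i).2 (σ i).val = G.dist i.val (σ i).val

/-- The catalyst `(σ, f)` induces the arrowflow `A`: the multiset of values of `f`
equals `A`. -/
def Induces {V : Type*} (S : Finset V) (f : {x // x ∈ S} → V × V)
    (A : Multiset (V × V)) : Prop :=
  Multiset.map f (Finset.univ : Finset {x // x ∈ S}).val = A

/-- The signed enumeration of the `S`-catalysts for `G` inducing the arrowflow `A`. -/
noncomputable def classSum {V : Type*} [Fintype V] (G : SimpleGraph V) (S : Finset V)
    (A : Multiset (V × V)) : ℤ :=
  ∑ κ ∈ Finset.univ.filter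
      (fun κ : Equiv.Perm {x // x ∈ S} × ({x // x ∈ S} → V × V) =>
        IsCatalyst G S κ.1 κ.2 ∧ Induces S κ.2 A),
    (Equiv.Perm.sign κ.1 : ℤ)

/-- The vertex `x` lies on the head side of the arc `e`: it is joined to `e.2` without using the
edge underlying `e`. -/
def OnHeadSide {V : Type*} (G : SimpleGraph V) (e : V × V) (x : V) : Prop :=
  (G.deleteEdges {s(e.1, e.2)}).Reachable e.2 x

theorem onHeadSide_snd {V : Type*} (G : SimpleGraph V) (e : V × V) : OnHeadSide G e e.2 :=
  SimpleGraph.Reachable.refl _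

theorem not_onHeadSide_fst {V : Type*} {G : SimpleGraph V} (hG : G.IsTree) {e : V × V}
    (he : G.Adj e.1 e.2) : ¬ OnHeadSide G e e.1 := fun h =>
  SimpleGraph.isBridge_iff.mp
    (SimpleGraph.isAcyclic_iff_forall_adj_isBridge.mp hG.isAcyclic he) h.symm

theorem onHeadSide_iff_of_adj {V : Type*} {G : SimpleGraph V} {e : V × V} {x y : V}
    (h : G.Adj x y) (hne : s(x, y) ≠ s(e.1, e.2)) : OnHeadSide G e x ↔ OnHeadSide G e y := by
  have hxy : (G.deleteEdges {s(e.1, e.2)}).Adj x y := by simp [h, hne]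
  exact ⟨fun hx => hx.trans hxy.reachable, fun hy => hy.trans hxy.symm.reachable⟩

theorem onHeadSide_swap_iff {V : Type*} {G : SimpleGraph V} (hG : G.IsTree) {e : V × V}
    (he : G.Adj e.1 e.2) (x : V) : OnHeadSide G e.swap x ↔ ¬ OnHeadSide G e x := by
  constructor
  · intro h h'
    refine not_onHeadSide_fst hG he (h'.trans ?_)
    have h2 := SimpleGraph.Reachable.symm h
    rwa [Prod.fst_swap, Prod.snd_swap, Sym2.eq_swap] at h2
  · have key {x y : V} (p : G.Walk x y) (hy : y = e.1) (h : ¬ OnHeadSide G e x) :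
        OnHeadSide G e.swap x := by
      induction p with
      | nil => exact hy ▸ onHeadSide_snd G e.swap
      | @cons a b c hab p ih =>
        by_cases hne : s(a, b) = s(e.1, e.2)
        · rcases Sym2.eq_iff.mp hne with ⟨ha, -⟩ | ⟨ha, -⟩
          · exact ha ▸ onHeadSide_snd G e.swap
          · exact absurd (ha ▸ onHeadSide_snd G e) h
        · refine (onHeadSide_iff_of_adj hab ?_).mpr (ih hy ?_)
          · rwa [Prod.fst_swap, Prod.snd_swap, Sym2.eq_swap (a := e.2)]
          · rwa [← onHeadSide_iff_of_adj hab hne]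
    obtain ⟨p⟩ := hG.connected.preconnected x e.1
    exact key p rfl

/-- The arc `e` is traversed by the path from `i` to `j` iff `e` separates `i` from `j`. -/
theorem dist_add_one_add_dist_eq_iff {V : Type*} {G : SimpleGraph V} (hG : G.IsTree) {e : V × V}
    (he : G.Adj e.1 e.2) (i j : V) :
    G.dist i e.1 + 1 + G.dist e.2 j = G.dist i j ↔ ¬ OnHeadSide G e i ∧ OnHeadSide G e j := by
  have hle {e : V × V} {i j : V} (p : G.Walk i j) (hi : ¬ OnHeadSide G e i)
      (hj : OnHeadSide G e j) : G.dist i e.1 + 1 + G.dist e.2 j ≤ p.length := by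
    induction p with
    | nil => exact absurd hj hi
    | @cons a b c hab p ih =>
      rw [SimpleGraph.Walk.length_cons]
      by_cases hb : OnHeadSide G e b
      · have hab' : s(a, b) = s(e.1, e.2) := by
          by_contra hne
          exact hi ((onHeadSide_iff_of_adj hab hne).mpr hb)
        rcases Sym2.eq_iff.mp hab' with ⟨rfl, rfl⟩ | ⟨rfl, rfl⟩
        · have := SimpleGraph.dist_le p
          simp only [SimpleGraph.dist_self]
          omega
        · exact absurd (onHeadSide_snd G e) hi
      · have h1 := ih hb hj
        have h2 := hG.connected.dist_triangle (u := a) (v := b) (w := e.1)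
        rw [SimpleGraph.dist_eq_one_iff_adj.mpr hab] at h2
        omega
  have heq {e : V × V} (he : G.Adj e.1 e.2) {i j : V} (hi : ¬ OnHeadSide G e i)
      (hj : OnHeadSide G e j) : G.dist i e.1 + 1 + G.dist e.2 j = G.dist i j := by
    obtain ⟨p, hp⟩ := hG.connected.exists_walk_length_eq_dist i j
    have h1 := hle p hi hj
    have h2 := hG.connected.dist_triangle (u := i) (v := e.1) (w := j)
    have h3 := hG.connected.dist_triangle (u := e.1) (v := e.2) (w := j)
    rw [SimpleGraph.dist_eq_one_iff_adj.mpr he] at h3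
    omega
  refine ⟨fun h => ?_, fun h => heq he h.1 h.2⟩
  have hfst := not_onHeadSide_fst hG he
  have hsnd := onHeadSide_snd G e
  have hswap := onHeadSide_swap_iff hG he
  have htri := hG.connected.dist_triangle (u := i) (v := e.1) (w := j)
  have htri' := hG.connected.dist_triangle (u := i) (v := e.2) (w := j)
  constructor
  · intro hi
    have h1 := heq (e := e.swap) he.symm (i := i) (j := e.1) (by simpa [hswap] using hi)
      (by simpa [hswap] using hfst)
    simp only [Prod.fst_swap, Prod.snd_swap, SimpleGraph.dist_self] at h1
    omega
  · by_contra hj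
    have h1 := heq (e := e.swap) he.symm (i := e.2) (j := j) (by simpa [hswap] using hsnd)
      (by simpa [hswap] using hj)
    simp only [Prod.fst_swap, Prod.snd_swap, SimpleGraph.dist_self] at h1
    omega

/-- The edges of `G` missing from `F`, oriented away from `r`. -/
def missingArcs {V : Type*} (G F : SimpleGraph V) (r : V) : Set (V × V) :=
  {e | G.Adj e.1 e.2 ∧ ¬ F.Adj e.1 e.2 ∧ ¬ OnHeadSide G e r}

theorem mem_or_swap_mem_missingArcs {V : Type*} {G F : SimpleGraph V} (hG : G.IsTree) (r : V)
    {e : V × V} (he : G.Adj e.1 e.2) (hF : ¬ F.Adj e.1 e.2) :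
    e ∈ missingArcs G F r ∨ e.swap ∈ missingArcs G F r := by
  by_cases h : OnHeadSide G e r
  · exact Or.inr ⟨he.symm, fun h' => hF h'.symm, by simpa [onHeadSide_swap_iff hG he] using h⟩
  · exact Or.inl ⟨he, hF, h⟩

theorem eq_of_mem_missingArcs {V : Type*} {G F : SimpleGraph V} (hG : G.IsTree) {r : V}
    {e e' : V × V} (he : e ∈ missingArcs G F r) (he' : e' ∈ missingArcs G F r)
    (h : s(e.1, e.2) = s(e'.1, e'.2)) : e = e' := by
  rcases Sym2.eq_iff.mp h with ⟨h1, h2⟩ | ⟨h1, h2⟩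
  · exact Prod.ext h1 h2
  · have : e' = e.swap := Prod.ext h2.symm h1.symm
    subst this
    exact absurd ((onHeadSide_swap_iff hG he.1 r).mpr he.2.2) he'.2.2

theorem onHeadSide_iff_of_reachable {V : Type*} {G F : SimpleGraph V} (hFG : F ≤ G) {r : V}
    {e : V × V} (he : e ∈ missingArcs G F r) {x y : V} (h : F.Reachable x y) :
    OnHeadSide G e x ↔ OnHeadSide G e y := by
  obtain ⟨p⟩ := h
  induction p with
  | nil => rfl
  | @cons a b c hab p ih =>
    refine (onHeadSide_iff_of_adj (hFG hab) fun heq => he.2.1 ?_).trans ih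
    rw [← SimpleGraph.mem_edgeSet] at hab ⊢
    exact heq ▸ hab

/-- The integer indicator of `x` lying on the head side of `e`. -/
noncomputable def headSideInd {V : Type*} (G : SimpleGraph V) (x : V) (e : V × V) : ℤ :=
  if OnHeadSide G e x then 1 else 0

theorem headSideInd_snd_sub_fst {V : Type*} {G F : SimpleGraph V} (hG : G.IsTree) {r : V}
    {e e' : V × V} (he : e ∈ missingArcs G F r) (he' : e' ∈ missingArcs G F r) :
    headSideInd G e.2 e' - headSideInd G e.1 e' = if e = e' then 1 else 0 := by
  split_ifs with h
  · subst h
    simp [headSideInd, onHeadSide_snd, not_onHeadSide_fst hG he.1]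
  · have := onHeadSide_iff_of_adj he.1 fun h' => h (eq_of_mem_missingArcs hG he he' h')
    simp [headSideInd, this]

theorem sum_headSideInd_mul_sub {V : Type*} [Fintype V] {G F : SimpleGraph V} (hG : G.IsTree)
    (hFG : F ≤ G) (r : V) (φ : V → ℤ) (hφ : ∀ x y, F.Adj x y → φ x = φ y) (x : V) :
    ∑ e : missingArcs G F r, headSideInd G x e * (φ e.1.2 - φ e.1.1) = φ x - φ r := by
  obtain ⟨p⟩ := hG.connected.preconnected x r
  induction p with
  | nil =>
    rw [sub_self]
    exact Finset.sum_eq_zero fun e _ => by simp [headSideInd, e.2.2.2]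
  | @cons a b r hab p ih =>
    have key {r a b : V} (hm : (a, b) ∈ missingArcs G F r) :
        ∑ e : missingArcs G F r, headSideInd G b e * (φ e.1.2 - φ e.1.1) -
        ∑ e : missingArcs G F r, headSideInd G a e * (φ e.1.2 - φ e.1.1) = φ b - φ a := by
      rw [← Finset.sum_sub_distrib, Finset.sum_eq_single ⟨(a, b), hm⟩]
      · rw [← sub_mul]
        have := headSideInd_snd_sub_fst hG hm hm
        simp only [if_true] at this
        rw [this, one_mul]
      · intro e _ hne
        rw [← sub_mul]
        have := headSideInd_snd_sub_fst hG hm e.2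
        rw [if_neg fun h => hne (Subtype.ext h.symm)] at this
        simp only [this, zero_mul]
      · simp
    by_cases hF : F.Adj a b
    · rw [hφ a b hF, ← ih]
      refine Finset.sum_congr rfl fun e _ => ?_
      simp only [headSideInd, onHeadSide_iff_of_reachable hFG e.2 hF.reachable]
    · rcases mem_or_swap_mem_missingArcs hG r (e := (a, b)) hab hF with hm | hm
      · linarith [key hm]
      · linarith [key (a := b) (b := a) hm]

theorem sum_bijective_prod_eq {S E R : Type*} [Fintype S] [DecidableEq S] [Fintype E]
    [DecidableEq E] [CommRing R]
    (hcard : Fintype.card S = Fintype.card E) (c : S → E → R) :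
    ∑ g : S → E with g.Bijective, ∏ i, c i (g i) =
      ∑ Z : Finset E, (-1) ^ Z.card * ∏ i, ∑ e ∈ Zᶜ, c i e := by
  have key (g : S → E) : ∑ Z : Finset E, (if ∀ i, g i ∈ Zᶜ then (-1 : R) ^ Z.card else 0) =
      if g.Bijective then 1 else 0 := by
    have hfil : ({Z : Finset E | ∀ i, g i ∈ Zᶜ} : Finset (Finset E)) =
        ((Finset.univ.image g)ᶜ).powerset := by
      ext Z
      simp only [Finset.mem_compl, Finset.mem_filter, Finset.mem_univ, true_and,
        Finset.mem_powerset, Finset.subset_iff, Finset.mem_image, not_exists]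
      exact ⟨fun h x hx i hi => h i (hi ▸ hx), fun h i hi => h hi i rfl⟩
    rw [← Finset.sum_filter, hfil]
    have h := congrArg (Int.cast : ℤ → R)
      (Finset.sum_powerset_neg_one_pow_card (x := (Finset.univ.image g)ᶜ))
    push_cast at h
    rw [h]
    have : (Finset.univ.image g)ᶜ = ∅ ↔ g.Bijective := by
      rw [Fintype.bijective_iff_surjective_and_card, and_iff_left hcard,
        Finset.compl_eq_empty_iff, Finset.eq_univ_iff_forall]
      simp [Function.Surjective]
    simp only [this]
  simp_rw [Finset.prod_univ_sum, Finset.mul_sum]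
  have (Z : Finset E) :
      ∑ g ∈ Fintype.piFinset (fun _ : S => Zᶜ), (-1 : R) ^ Z.card * ∏ i, c i (g i) =
      ∑ g : S → E, (if ∀ i, g i ∈ Zᶜ then (-1 : R) ^ Z.card else 0) * ∏ i, c i (g i) := by
    simp_rw [ite_mul, zero_mul]
    rw [← Finset.sum_filter]
    congr 1
    ext g
    simp
  simp_rw [this]
  rw [Finset.sum_comm]
  simp_rw [← Finset.sum_mul, key]
  simp [Finset.sum_filter]

/-- The matrix `w uᵀ + u wᵀ - 2 diag w`, where `w` is the indicator vector of the complement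
of `Z`. -/
def rankTwoUpdate {E R : Type*} [DecidableEq E] [CommRing R] (u : E → R) (Z : Finset E) :
    Matrix E E R :=
  Matrix.of fun e f => (if e ∈ Z then 0 else 1) * u f + u e * (if f ∈ Z then 0 else 1)
    - 2 * (if e = f ∧ e ∉ Z then 1 else 0)

theorem det_rankTwoUpdate_of_two_le {E R : Type*} [Fintype E] [DecidableEq E] [CommRing R]
    (u : E → R) (hu : ∀ e, u e = 0 ∨ u e = 1) (Z : Finset E) (hZ : 2 ≤ Z.card) :
    (rankTwoUpdate u Z).det = 0 := by
  obtain ⟨e, he, f, hf, hef⟩ := Finset.one_lt_card.mp hZ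
  rcases hu e with h | h
  · exact Matrix.det_eq_zero_of_row_eq_zero e (by simp [rankTwoUpdate, he, h])
  rcases hu f with h' | h'
  · exact Matrix.det_eq_zero_of_row_eq_zero f (by simp [rankTwoUpdate, hf, h'])
  · exact Matrix.det_zero_of_row_eq hef (by ext; simp [rankTwoUpdate, he, hf, h, h'])

theorem det_rankTwoUpdate_empty {E : Type*} [Fintype E] [DecidableEq E] (u : E → ℚ)
    (hu : ∀ e, u e = 0 ∨ u e = 1) :
    (rankTwoUpdate u ∅).det = (-2) ^ Fintype.card E *
      ((1 - (∑ e, u e) / 2) ^ 2 - Fintype.card E * (∑ e, u e) / 4) := by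
  let P : Matrix E (Fin 2) ℚ := Matrix.of fun e => ![1, u e]
  let Q : Matrix (Fin 2) E ℚ := Matrix.of ![fun e => -u e / 2, fun _ => -1 / 2]
  have h : rankTwoUpdate u ∅ = (-2 : ℚ) • (1 + P * Q) := by
    ext e f
    simp [rankTwoUpdate, P, Q, Matrix.mul_apply, Fin.sum_univ_two, Matrix.one_apply]
    split_ifs <;> ring
  have huu (e : E) : u e * u e = u e := by rcases hu e with h | h <;> simp [h]
  rw [h, Matrix.det_smul, Matrix.det_one_add_mul_comm, Matrix.det_fin_two]
  simp only [P, Q, Matrix.add_apply, Matrix.mul_apply, Matrix.one_apply, Matrix.of_apply,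
    Matrix.cons_val_zero, Matrix.cons_val_one, neg_div, div_mul_eq_mul_div, neg_mul, huu,
    Finset.sum_neg_distrib, ← Finset.sum_div, mul_one, one_mul]
  simp
  ring

theorem det_rankTwoUpdate_singleton {E : Type*} [Fintype E] [DecidableEq E] (u : E → ℚ)
    (hu : ∀ e, u e = 0 ∨ u e = 1) (z : E) :
    (rankTwoUpdate u {z}).det = (-2) ^ Fintype.card E *
      (-(u z * (Fintype.card E - 1) / 4)) := by
  let w : E → ℚ := fun e => if e = z then 0 else 1
  let P : Matrix E (Fin 3) ℚ := Matrix.of fun e => ![w e, u e, 1 - w e]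
  let Q : Matrix (Fin 3) E ℚ :=
    Matrix.of ![fun e => -u e / 2, fun e => -w e / 2, fun e => -(1 - w e)]
  have h : rankTwoUpdate u {z} = (-2 : ℚ) • (1 + P * Q) := by
    ext e f
    simp only [rankTwoUpdate, P, Q, w, Matrix.mul_apply, Fin.sum_univ_three, Matrix.one_apply,
      Finset.mem_singleton, Matrix.of_apply, Matrix.smul_apply, Matrix.add_apply, smul_eq_mul,
      Matrix.cons_val]
    by_cases he : e = z <;> by_cases hf : f = z <;> by_cases hef : e = f <;>
      simp_all <;> ring
  have huu (e : E) : u e * u e = u e := by rcases hu e with h | h <;> simp [h]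
  have hww (e : E) : w e * w e = w e := by simp only [w]; split_ifs <;> simp
  have hw : ∑ e, w e = Fintype.card E - 1 := by
    simp [w, Finset.sum_ite, Finset.filter_ne', Finset.card_erase_of_mem,
      Nat.cast_sub (Fintype.card_pos_iff.mpr ⟨z⟩)]
  have huw : ∑ e, u e * w e = ∑ e, u e - u z := by
    rw [eq_sub_iff_add_eq, ← Finset.sum_erase_add _ _ (Finset.mem_univ z)]
    simp [w, Finset.sum_ite, Finset.filter_ne']
  rw [h, Matrix.det_smul, Matrix.det_one_add_mul_comm, Matrix.det_fin_three]
  have hwu : ∑ e, w e * u e = ∑ e, u e - u z := by simp_rw [mul_comm (w _), huw]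
  have huz := huu z
  simp only [P, Q, Matrix.add_apply, Matrix.mul_apply, Matrix.one_apply, Matrix.of_apply,
    Matrix.cons_val, neg_div, div_mul_eq_mul_div, neg_mul, huu, mul_sub, sub_mul, hww,
    Finset.sum_neg_distrib, Finset.sum_sub_distrib, ← Finset.sum_div, mul_one, one_mul, hw,
    huw, hwu]
  simp
  linear_combination ((-2) ^ Fintype.card E * (-(1:ℚ) / 4) * (Fintype.card E - 1)) * huz

theorem sum_det_rankTwoUpdate {E : Type*} [Fintype E] [DecidableEq E] (u : E → ℤ)
    (hu : ∀ e, u e = 0 ∨ u e = 1) (hE : 2 ≤ Fintype.card E) :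
    ∑ Z : Finset E, (-1) ^ Z.card * (rankTwoUpdate u Z).det =
      (-1) ^ Fintype.card E * 2 ^ (Fintype.card E - 2) * (∑ e, u e - 1) * (∑ e, u e - 4) := by
  have hsub : ∑ Z : Finset E, (-1) ^ Z.card * (rankTwoUpdate u Z).det =
      (rankTwoUpdate u ∅).det - ∑ z, (rankTwoUpdate u {z}).det := by
    rw [← Finset.sum_subset (Finset.subset_univ
      (insert ∅ (Finset.univ.map ⟨fun z : E => ({z} : Finset E), Finset.singleton_injective⟩)))]
    · rw [Finset.sum_insert (by simp), Finset.sum_map]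
      simp [sub_eq_add_neg]
    · intro Z _ hZ
      rw [det_rankTwoUpdate_of_two_le u hu Z, mul_zero]
      by_contra hlt
      have : Z.card = 0 ∨ Z.card = 1 := by omega
      rcases this with h | h
      · simp [Finset.card_eq_zero.mp h] at hZ
      · obtain ⟨z, rfl⟩ := Finset.card_eq_one.mp h
        simp at hZ
  have hcast (Z : Finset E) : (((rankTwoUpdate u Z).det : ℤ) : ℚ) =
      (rankTwoUpdate (fun e => (u e : ℚ)) Z).det := by
    refine ((Int.castRingHom ℚ).map_det _).trans ?_
    congr 1
    ext e f
    simp [rankTwoUpdate, apply_ite (Int.cast : ℤ → ℚ)]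
  have hu' (e : E) : (u e : ℚ) = 0 ∨ (u e : ℚ) = 1 := by exact_mod_cast hu e
  have hq : ((∑ Z : Finset E, (-1) ^ Z.card * (rankTwoUpdate u Z).det : ℤ) : ℚ) =
      (((-1) ^ Fintype.card E * 2 ^ (Fintype.card E - 2) * (∑ e, u e - 1) *
        (∑ e, u e - 4) : ℤ) : ℚ) := by
    rw [hsub, Int.cast_sub, Int.cast_sum]
    simp_rw [hcast, det_rankTwoUpdate_singleton (fun e => (u e : ℚ)) hu']
    rw [det_rankTwoUpdate_empty (fun e => (u e : ℚ)) hu']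
    push_cast
    obtain ⟨k, hk⟩ := Nat.exists_eq_add_of_le' hE
    rw [hk, Nat.add_sub_cancel, ← Finset.mul_sum, Finset.sum_neg_distrib, ← Finset.sum_div,
      ← Finset.sum_mul, neg_pow (2 : ℚ), pow_add 2 k 2]
    ring
  exact_mod_cast hq

theorem sum_perm_sum_bijective_eq {S E : Type*} [Fintype S] [DecidableEq S] [Fintype E]
    [DecidableEq E] (a : Matrix S E ℤ) (c : Matrix E S ℤ) (hac : a * c = 1)
    (hcard : Fintype.card S = Fintype.card E) (hS : 2 ≤ Fintype.card S)
    (u : E → ℤ) (hu : ∀ e, u e = 0 ∨ u e = 1) (hau : ∀ i, ∑ e, a i e * u e = 1) :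
    ∑ σ : Equiv.Perm S, ∑ g : S → E with g.Bijective, (Equiv.Perm.sign σ : ℤ) *
        ∏ i, (a i (g i) + a (σ i) (g i) - 2 * a i (g i) * a (σ i) (g i)) =
      (-1) ^ Fintype.card S * 2 ^ (Fintype.card S - 2) * (∑ e, u e - 1) * (∑ e, u e - 4) := by
  rw [hcard, ← sum_det_rankTwoUpdate u hu (hcard ▸ hS)]
  have hdet (Z : Finset E) : (rankTwoUpdate u Z).det = ∑ σ : Equiv.Perm S,
      (Equiv.Perm.sign σ : ℤ) *
        ∏ i, ∑ e ∈ Zᶜ, (a i e + a (σ i) e - 2 * a i e * a (σ i) e) := by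
    let ε : S ≃ E := Fintype.equivOfCardEq hcard
    have h1 : (a.submatrix id ε).det * (c.submatrix ε id).det = 1 := by
      rw [← Matrix.det_mul, Matrix.submatrix_mul_equiv, hac]
      simp
    have h2 : (a.submatrix id ε).det * (a.submatrix id ε).det = 1 := by
      rcases Int.eq_one_or_neg_one_of_mul_eq_one h1 with h | h <;> simp [h]
    have h3 : (rankTwoUpdate u Z).det = (a * rankTwoUpdate u Z * a.transpose).det := by
      have : a * rankTwoUpdate u Z * a.transpose = a.submatrix id ε *
          (rankTwoUpdate u Z).submatrix ε ε * (a.submatrix id ε).transpose := by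
        rw [Matrix.transpose_submatrix, Matrix.submatrix_mul_equiv, Matrix.submatrix_mul_equiv,
          Matrix.submatrix_id_id]
      rw [this, Matrix.det_mul, Matrix.det_mul, Matrix.det_transpose,
        Matrix.det_submatrix_equiv_self]
      linear_combination (-(rankTwoUpdate u Z).det) * h2
    have h4 (i j : S) : (a * rankTwoUpdate u Z * a.transpose) i j =
        ∑ e ∈ Zᶜ, (a i e + a j e - 2 * a i e * a j e) := by
      have hw (x : E → ℤ) : ∑ e ∈ Zᶜ, x e = ∑ e, (if e ∈ Z then 0 else 1) * x e := by
        rw [Finset.compl_eq_univ_sdiff, ← Finset.filter_notMem_eq_sdiff, Finset.sum_filter]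
        refine Finset.sum_congr rfl fun e _ => ?_
        split_ifs <;> simp_all
      have hd (e f : E) : (if e = f ∧ e ∉ Z then (1 : ℤ) else 0) =
          if e = f then (if e ∈ Z then 0 else 1) else 0 := by
        split_ifs <;> simp_all
      have hi := hau i
      have hj := hau j
      simp only [Matrix.mul_apply, Matrix.transpose_apply, rankTwoUpdate, Matrix.of_apply, hw, hd,
        mul_sub, mul_add, sub_mul, add_mul, Finset.sum_add_distrib, Finset.sum_sub_distrib,
        Finset.sum_mul]
      have e1 : ∑ x, ∑ y, a i y * ((if y ∈ Z then 0 else 1) * u x) * a j x =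
          ∑ e, (if e ∈ Z then 0 else 1) * a i e := by
        calc _ = ∑ x, (a j x * u x) * ∑ y, (if y ∈ Z then 0 else 1) * a i y := by
              refine Finset.sum_congr rfl fun x _ => ?_
              rw [Finset.mul_sum]
              exact Finset.sum_congr rfl fun y _ => by ring
          _ = _ := by rw [← Finset.sum_mul, hj, one_mul]
      have e2 : ∑ x, ∑ y, a i y * (u y * (if x ∈ Z then 0 else 1)) * a j x =
          ∑ e, (if e ∈ Z then 0 else 1) * a j e := by
        calc _ = ∑ x, (∑ y, a i y * u y) * ((if x ∈ Z then 0 else 1) * a j x) := by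
              refine Finset.sum_congr rfl fun x _ => ?_
              rw [Finset.sum_mul]
              exact Finset.sum_congr rfl fun y _ => by ring
          _ = _ := by simp_rw [hi, one_mul]
      rw [e1, e2]
      congr 1
      refine Finset.sum_congr rfl fun x _ => ?_
      rw [Finset.sum_eq_single x (by simp +contextual) (by simp)]
      simp only [if_true]
      ring
    rw [h3, ← Matrix.det_transpose, Matrix.det_apply']
    simp_rw [Matrix.transpose_apply, h4]
    rfl
  have hσ (σ : Equiv.Perm S) : ∑ g : S → E with g.Bijective, (Equiv.Perm.sign σ : ℤ) *
        ∏ i, (a i (g i) + a (σ i) (g i) - 2 * a i (g i) * a (σ i) (g i)) =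
      ∑ Z : Finset E, (Equiv.Perm.sign σ : ℤ) * ((-1) ^ Z.card *
        ∏ i, ∑ e ∈ Zᶜ, (a i e + a (σ i) e - 2 * a i e * a (σ i) e)) := by
    rw [← Finset.mul_sum, ← Finset.mul_sum]
    exact congrArg _ (sum_bijective_prod_eq hcard
      fun i e => a i e + a (σ i) e - 2 * a i e * a (σ i) e)
  simp_rw [hσ, hdet, Finset.mul_sum]
  rw [Finset.sum_comm]
  exact Finset.sum_congr rfl fun Z _ => Finset.sum_congr rfl fun σ _ => by ring

theorem prod_xor_indicator_eq {S : Type*} [Fintype S] (p q : S → Prop) :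
    ∏ i, ((if p i then (1 : ℤ) else 0) + (if q i then 1 else 0)
      - 2 * (if p i then 1 else 0) * (if q i then 1 else 0)) =
      if ∀ i, ¬ (p i ↔ q i) then 1 else 0 := by
  have (i : S) : ((if p i then (1 : ℤ) else 0) + (if q i then 1 else 0)
      - 2 * (if p i then 1 else 0) * (if q i then 1 else 0)) =
      if ¬ (p i ↔ q i) then 1 else 0 := by
    by_cases hp : p i <;> by_cases hq : q i <;> simp [hp, hq]
  simp_rw [this]
  rw [Finset.prod_boole]
  simp

section Forest

variable {V : Type*} {G F : SimpleGraph V} {S : Finset V} {r : V}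

theorem mem_floatSet_iff_reachable (hF : IsSStarRootedForest G F S) (hr : r ∈ floatSet F S)
    (v : V) : v ∈ floatSet F S ↔ F.Reachable r v :=
  ⟨hF.2.2.2.2 r hr v, fun h s hs hsv => hr s hs (hsv.trans h.symm)⟩

theorem snd_notMem_floatSet (hF : IsSStarRootedForest G F S) (hr : r ∈ floatSet F S)
    {e : V × V} (he : e ∈ missingArcs G F r) : e.2 ∉ floatSet F S := fun h =>
  he.2.2 ((onHeadSide_iff_of_reachable hF.1 he ((mem_floatSet_iff_reachable hF hr _).mp h)).mpr
    (onHeadSide_snd G e))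

theorem sum_headSideInd_mul_floatSet [Fintype V] (hG : G.IsTree) (hF : IsSStarRootedForest G F S)
    (hr : r ∈ floatSet F S) {i : V} (hi : i ∈ S) :
    ∑ e : missingArcs G F r, headSideInd G i e * (if e.1.1 ∈ floatSet F S then 1 else 0) = 1 := by
  have h := sum_headSideInd_mul_sub hG hF.1 r (fun v => if v ∈ floatSet F S then (-1 : ℤ) else 0)
    (fun x y hxy => by
      simp only [mem_floatSet_iff_reachable hF hr]
      have : F.Reachable r x ↔ F.Reachable r y :=
        ⟨fun h => h.trans hxy.reachable, fun h => h.trans hxy.symm.reachable⟩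
      simp only [this]) i
  have hi' : i ∉ floatSet F S := fun h => h i hi (SimpleGraph.Reachable.refl _)
  simp only [hi', hr, if_true, if_false] at h
  rw [show (0 : ℤ) - -1 = 1 by norm_num] at h
  refine Eq.trans (Finset.sum_congr rfl fun e _ => ?_) h
  rw [if_neg (snd_notMem_floatSet hF hr e.2)]
  split_ifs <;> simp

theorem sum_floatSet_eq_bdeg [Fintype V] (hG : G.IsTree) (hF : IsSStarRootedForest G F S)
    (hr : r ∈ floatSet F S) :
    ∑ e : missingArcs G F r, (if e.1.1 ∈ floatSet F S then (1 : ℤ) else 0) = bdeg G F S := by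
  rw [Finset.sum_boole, bdeg, Set.ncard_eq_toFinset_card']
  norm_cast
  refine Finset.card_bij (fun e _ => e.1.2) ?_ ?_ ?_
  · intro e he
    simp only [Finset.mem_filter, Finset.mem_univ, true_and] at he
    simpa using ⟨snd_notMem_floatSet hF hr e.2, _, he, e.2.1.symm⟩
  · intro e he e' he' h
    simp only [Finset.mem_filter, Finset.mem_univ, true_and] at he he'
    by_contra hne
    have hadj := onHeadSide_iff_of_adj (e := e.1) e'.2.1 fun h' =>
      hne (Subtype.ext (eq_of_mem_missingArcs hG e.2 e'.2 h'.symm))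
    have := hadj.mpr (h ▸ onHeadSide_snd G e.1)
    rw [← onHeadSide_iff_of_reachable hF.1 e.2
      ((mem_floatSet_iff_reachable hF hr _).mp he')] at this
    exact e.2.2.2 this
  · intro v hv
    simp only [Set.mem_toFinset, Set.mem_ofPred_eq] at hv
    obtain ⟨hv, w, hw, hvw⟩ := hv
    have hFvw : ¬ F.Adj w v := fun h => hv ((mem_floatSet_iff_reachable hF hr _).mpr
      (((mem_floatSet_iff_reachable hF hr _).mp hw).trans h.reachable))
    rcases mem_or_swap_mem_missingArcs hG r (e := (w, v)) hvw.symm hFvw with h | h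
    · exact ⟨⟨_, h⟩, by simpa using hw, rfl⟩
    · exact absurd hw (snd_notMem_floatSet hF hr h)

/-- The integer indicator of `v` lying in the component of `j` in `F`. -/
noncomputable def componentInd (F : SimpleGraph V) (j v : V) : ℤ :=
  if F.Reachable j v then 1 else 0

/-- The incidence matrix between `S` and the missing arcs recording head sides. -/
noncomputable def headSideMatrix (G F : SimpleGraph V) (S : Finset V) (r : V) :
    Matrix S (missingArcs G F r) ℤ :=
  Matrix.of fun i e => headSideInd G i e

/-- The incidence matrix between the missing arcs and the components of `F` rooted at `S`. -/
noncomputable def componentMatrix (G F : SimpleGraph V) (S : Finset V) (r : V) :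
    Matrix (missingArcs G F r) S ℤ :=
  Matrix.of fun e j => componentInd F j e.1.2 - componentInd F j e.1.1

theorem headSideMatrix_mul_componentMatrix [Fintype V] (hG : G.IsTree)
    (hF : IsSStarRootedForest G F S) (hr : r ∈ floatSet F S) : headSideMatrix G F S r * componentMatrix G F S r = 1 := by
  ext i j
  have h := sum_headSideInd_mul_sub hG hF.1 r (componentInd F j)
    (fun x y hxy => by
      have : F.Reachable j x ↔ F.Reachable j y :=
        ⟨fun h => h.trans hxy.reachable, fun h => h.trans hxy.symm.reachable⟩
      by_cases h : F.Reachable j y <;> simp [componentInd, this, h]) i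
  simp only [Matrix.mul_apply, headSideMatrix, componentMatrix, Matrix.of_apply]
  rw [h, Matrix.one_apply]
  have h0 : ¬ F.Reachable j r := hr j j.2
  have h1 : F.Reachable j i ↔ i = j :=
    ⟨fun h => Subtype.ext (hF.2.2.1 j j.2 i i.2 h).symm, fun h => h ▸ SimpleGraph.Reachable.refl _⟩
  simp [componentInd, h0, h1]

theorem sum_componentInd_mul_headSideInd (hF : IsSStarRootedForest G F S)
    (hr : r ∈ floatSet F S) {e : V × V} (he : e ∈ missingArcs G F r) (v : V) :
    ∑ j : S, componentInd F j v * headSideInd G j e = headSideInd G v e := by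
  by_cases hv : v ∈ floatSet F S
  · have h1 : headSideInd G v e = 0 := if_neg fun h => he.2.2
      ((onHeadSide_iff_of_reachable hF.1 he ((mem_floatSet_iff_reachable hF hr _).mp hv)).mpr h)
    rw [h1]
    exact Finset.sum_eq_zero fun j _ => by simp [componentInd, hv j j.2]
  · simp only [floatSet, Set.mem_ofPred_eq, not_forall, not_not] at hv
    obtain ⟨s, hs, hsv⟩ := hv
    rw [Finset.sum_eq_single ⟨s, hs⟩]
    · simp [componentInd, headSideInd, hsv, onHeadSide_iff_of_reachable hF.1 he hsv]
    · intro j _ hj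
      have : ¬ F.Reachable j v := fun h =>
        hj (Subtype.ext (hF.2.2.1 j j.2 s hs (h.trans hsv.symm)))
      simp [componentInd, this]
    · simp

theorem componentMatrix_mul_headSideMatrix [Fintype V] (hG : G.IsTree)
    (hF : IsSStarRootedForest G F S) (hr : r ∈ floatSet F S) : componentMatrix G F S r * headSideMatrix G F S r = 1 := by
  ext e e'
  simp only [Matrix.mul_apply, headSideMatrix, componentMatrix, Matrix.of_apply, sub_mul,
    Finset.sum_sub_distrib]
  rw [sum_componentInd_mul_headSideInd hF hr e'.2, sum_componentInd_mul_headSideInd hF hr e'.2,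
    headSideInd_snd_sub_fst hG e.2 e'.2, Matrix.one_apply]
  simp [Subtype.ext_iff]

theorem card_eq_card_missingArcs [Fintype V] (hG : G.IsTree) (hF : IsSStarRootedForest G F S)
    (hr : r ∈ floatSet F S) : Fintype.card S = Fintype.card (missingArcs G F r) :=
  Matrix.square_of_invertible _ _ (headSideMatrix_mul_componentMatrix hG hF hr)
    (componentMatrix_mul_headSideMatrix hG hF hr)

/-- The sum of signs of pairs of a permutation `σ` of `S` and a bijection from `S` to the missing
arcs such that the arc assigned to `i` separates `i` from `σ i`. -/
theorem sum_separating_bijections [Fintype V] (hG : G.IsTree) (hF : IsSStarRootedForest G F S)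
    (hr : r ∈ floatSet F S) (hS : 2 ≤ S.card) :
    ∑ κ : Equiv.Perm S × (S → missingArcs G F r) with κ.2.Bijective ∧
        ∀ i : S, ¬ (OnHeadSide G (κ.2 i) i ↔ OnHeadSide G (κ.2 i) (κ.1 i)),
      (Equiv.Perm.sign κ.1 : ℤ) =
      (-1) ^ S.card * 2 ^ (S.card - 2) * ((bdeg G F S : ℤ) - 1) * ((bdeg G F S : ℤ) - 4) := by
  have h := sum_perm_sum_bijective_eq (headSideMatrix G F S r) (componentMatrix G F S r)
    (headSideMatrix_mul_componentMatrix hG hF hr) (card_eq_card_missingArcs hG hF hr)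
    (by simpa using hS) (fun e => if e.1.1 ∈ floatSet F S then 1 else 0)
    (fun e => by split_ifs <;> simp)
    (fun i => sum_headSideInd_mul_floatSet hG hF hr i.2)
  rw [sum_floatSet_eq_bdeg hG hF hr, Fintype.card_coe] at h
  rw [← h, Finset.sum_filter, Fintype.sum_prod_type]
  refine Finset.sum_congr (by congr!) fun σ _ => ?_
  rw [Finset.sum_filter]
  refine Finset.sum_congr rfl fun g _ => ?_
  simp only [headSideMatrix, headSideInd, Matrix.of_apply]
  rw [prod_xor_indicator_eq, mul_ite, mul_one, mul_zero, ← ite_and]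

/-- The arc `e` or its reversal, oriented so that `x` lies on its tail side. -/
noncomputable def orientFrom (G : SimpleGraph V) (x : V) (e : V × V) : V × V :=
  if OnHeadSide G e x then e.swap else e

theorem orientFrom_eq_or (x : V) (e : V × V) :
    orientFrom G x e = e ∨ orientFrom G x e = e.swap := by
  unfold orientFrom
  split_ifs <;> simp

theorem mk_orientFrom (x : V) (e : V × V) :
    s((orientFrom G x e).1, (orientFrom G x e).2) = s(e.1, e.2) := by
  rcases orientFrom_eq_or (G := G) x e with h | h
  · rw [h]
  · rw [h, Prod.fst_swap, Prod.snd_swap, Sym2.eq_swap]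

theorem dist_orientFrom_iff (hG : G.IsTree) {e : V × V} (he : G.Adj e.1 e.2) (i j : V) :
    G.dist i (orientFrom G i e).1 + 1 + G.dist (orientFrom G i e).2 j = G.dist i j ↔
      ¬ (OnHeadSide G e i ↔ OnHeadSide G e j) := by
  unfold orientFrom
  split_ifs with h
  · rw [dist_add_one_add_dist_eq_iff hG (e := e.swap) he.symm, onHeadSide_swap_iff hG he,
      onHeadSide_swap_iff hG he]
    tauto
  · rw [dist_add_one_add_dist_eq_iff hG he]
    tauto

theorem missingForest_adj_iff {A : Multiset (V × V)} {x y : V} :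
    (missingForest G A).Adj x y ↔ G.Adj x y ∧ (x, y) ∉ A ∧ (y, x) ∉ A := by
  simp only [missingForest, arrowSG, SimpleGraph.sdiff_adj, SimpleGraph.fromRel_adj]
  constructor
  · rintro ⟨h, h'⟩
    simp only [not_and, not_or] at h'
    exact ⟨h, h' h.ne⟩
  · rintro ⟨h, h1, h2⟩
    exact ⟨h, fun h' => h'.2.elim h1 h2⟩

theorem mem_map_iff {f : S → V × V} {p : V × V} :
    p ∈ Multiset.map f (Finset.univ : Finset S).val ↔ ∃ i, f i = p := by
  simp only [Multiset.mem_map, Finset.mem_val, Finset.mem_univ, true_and]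

theorem not_hasParallelArrows_map {f : S → V × V} (hf : f.Injective) :
    ¬ HasParallelArrows (Multiset.map f (Finset.univ : Finset S).val) := by
  rintro ⟨p, hp⟩
  have := Multiset.nodup_iff_count_le_one.mp (Finset.univ.nodup.map hf) p
  omega

theorem missingForest_map_orientFrom (hG : G.IsTree) (hFG : F ≤ G)
    {g : S → missingArcs G F r} (hg : g.Surjective) :
    missingForest G (Multiset.map (fun i : S => orientFrom G (i : V) (g i))
      (Finset.univ : Finset S).val) = F := by
  ext x y
  rw [missingForest_adj_iff]
  simp only [mem_map_iff, not_exists]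
  constructor
  · rintro ⟨h, h1, h2⟩
    by_contra hF
    rcases mem_or_swap_mem_missingArcs hG r (e := (x, y)) h hF with hm | hm
    · obtain ⟨i, hi⟩ := hg ⟨_, hm⟩
      rcases orientFrom_eq_or (G := G) (i : V) (g i) with h | h
      · exact h1 i (h.trans (by rw [hi]))
      · exact h2 i (h.trans (by rw [hi]; rfl))
    · obtain ⟨i, hi⟩ := hg ⟨_, hm⟩
      rcases orientFrom_eq_or (G := G) (i : V) (g i) with h | h
      · exact h2 i (h.trans (by rw [hi]; rfl))
      · exact h1 i (h.trans (by rw [hi]; rfl))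
  · intro h
    have key (i : S) : s(((g i).1).1, ((g i).1).2) ≠ s(x, y) := fun heq => by
      have h' := (SimpleGraph.mem_edgeSet F).mpr h
      rw [← heq] at h'
      exact (g i).2.2.1 h'
    refine ⟨hFG h, fun i hi => key i ?_, fun i hi => key i ?_⟩
    · rw [← mk_orientFrom (G := G) (i : V) (g i), hi]
    · rw [← mk_orientFrom (G := G) (i : V) (g i), hi, Sym2.eq_swap]

/-- Catalysts inducing a composite arrowflow with missing forest `F` correspond to bijections from
`S` to the missing arcs whose values separate `i` from `σ i`. -/
theorem sum_catalyst_eq_sum_separating_bijections [Fintype V] (hG : G.IsTree)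
    (hF : IsSStarRootedForest G F S) (hr : r ∈ floatSet F S) :
    ∑ κ : Equiv.Perm {x // x ∈ S} × ({x // x ∈ S} → V × V) with IsCatalyst G S κ.1 κ.2 ∧
        (IsArrowflow G S.card (Multiset.map κ.2 (Finset.univ : Finset {x // x ∈ S}).val) ∧
          IsComposite G S (Multiset.map κ.2 (Finset.univ : Finset {x // x ∈ S}).val) ∧
          missingForest G (Multiset.map κ.2 (Finset.univ : Finset {x // x ∈ S}).val) = F),
      (Equiv.Perm.sign κ.1 : ℤ) =
    ∑ κ : Equiv.Perm S × (S → missingArcs G F r) with κ.2.Bijective ∧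
        ∀ i : S, ¬ (OnHeadSide G (κ.2 i) i ↔ OnHeadSide G (κ.2 i) (κ.1 i)),
      (Equiv.Perm.sign κ.1 : ℤ) := by
  symm
  refine Finset.sum_bij (fun κ _ => (κ.1, fun i => orientFrom G (i : V) (κ.2 i))) ?_ ?_ ?_ ?_
  · rintro ⟨σ, g⟩ hκ
    simp only [Finset.mem_filter, Finset.mem_univ, true_and] at hκ ⊢
    obtain ⟨hg, hsep⟩ := hκ
    have hadj (i : S) : G.Adj (orientFrom G (i : V) (g i)).1 (orientFrom G (i : V) (g i)).2 := by
      rcases orientFrom_eq_or (G := G) (i : V) (g i) with h | h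
      · rw [h]; exact (g i).2.1
      · rw [h]; exact (g i).2.1.symm
    have hmf := missingForest_map_orientFrom hG hF.1 hg.2
    refine ⟨fun i => ⟨hadj i, (dist_orientFrom_iff hG (g i).2.1 _ _).mpr (hsep i)⟩,
      ⟨(Multiset.card_map _ _).trans (Fintype.card_coe S), ?_⟩,
      ⟨not_hasParallelArrows_map ?_, hmf.symm ▸ hF⟩, hmf⟩
    · intro p hp
      obtain ⟨i, rfl⟩ := mem_map_iff.mp hp
      exact hadj i
    · intro i j hij
      refine hg.1 (Subtype.ext (eq_of_mem_missingArcs hG (g i).2 (g j).2 ?_))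
      rw [← mk_orientFrom (G := G) (i : V) (g i), ← mk_orientFrom (G := G) (j : V) (g j)]
      exact congrArg (fun p : V × V => s(p.1, p.2)) hij
  · rintro ⟨σ, g⟩ - ⟨σ', g'⟩ - h
    simp only [Prod.mk.injEq] at h
    refine Prod.ext h.1 (funext fun i =>
      Subtype.ext (eq_of_mem_missingArcs hG (g i).2 (g' i).2 ?_))
    rw [← mk_orientFrom (G := G) (i : V) (g i), ← mk_orientFrom (G := G) (i : V) (g' i)]
    exact congrArg (fun p : V × V => s(p.1, p.2)) (congrFun h.2 i)
  · rintro ⟨σ, f⟩ hκ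
    simp only [Finset.mem_filter, Finset.mem_univ, true_and] at hκ
    obtain ⟨hcat, -, -, hmf⟩ := hκ
    have hnot (i : S) : ¬ F.Adj (f i).1 (f i).2 := by
      rw [← hmf, missingForest_adj_iff]
      exact fun h => h.2.1 (mem_map_iff.mpr ⟨i, rfl⟩)
    have hex (i : S) : ∃ e : missingArcs G F r, f i = orientFrom G (i : V) e ∧
        ¬ (OnHeadSide G e i ↔ OnHeadSide G e (σ i)) := by
      have hi := (dist_add_one_add_dist_eq_iff hG (hcat i).1 _ _).mp (hcat i).2
      rcases mem_or_swap_mem_missingArcs hG r (hcat i).1 (hnot i) with h | h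
      · exact ⟨⟨_, h⟩, by rw [orientFrom, if_neg hi.1], by simp [hi.1, hi.2]⟩
      · refine ⟨⟨_, h⟩, ?_, ?_⟩
        · rw [orientFrom, if_pos ((onHeadSide_swap_iff hG (hcat i).1 _).mpr hi.1), Prod.swap_swap]
        · rw [onHeadSide_swap_iff hG (hcat i).1, onHeadSide_swap_iff hG (hcat i).1]
          simp [hi.1, hi.2]
    choose g hg hsep using hex
    have hsurj : g.Surjective := by
      intro e
      have he : ¬ (missingForest G _).Adj e.1.1 e.1.2 := fun h => e.2.2.1 (hmf.le h)
      rw [missingForest_adj_iff] at he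
      have : ∃ i, s((f i).1, (f i).2) = s(e.1.1, e.1.2) := by
        by_contra! hne
        refine he ⟨e.2.1, fun h => ?_, fun h => ?_⟩
        · obtain ⟨i, hi⟩ := mem_map_iff.mp h
          exact hne i (by rw [hi])
        · obtain ⟨i, hi⟩ := mem_map_iff.mp h
          exact hne i (by rw [hi, Sym2.eq_swap])
      obtain ⟨i, hi⟩ := this
      refine ⟨i, Subtype.ext (eq_of_mem_missingArcs hG (g i).2 e.2 ?_)⟩
      rw [← hi, hg, mk_orientFrom]
    refine ⟨(σ, g), ?_, Prod.ext rfl (funext fun i => (hg i).symm)⟩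
    simp only [Finset.mem_filter, Finset.mem_univ, true_and]
    exact ⟨(Fintype.bijective_iff_surjective_and_card g).mpr
      ⟨hsurj, card_eq_card_missingArcs hG hF hr⟩, hsep⟩
  · rintro ⟨σ, g⟩ -
    rfl

theorem finsum_mem_classSum [Fintype V] (G : SimpleGraph V) (S : Finset V)
    (X : Set (Multiset (V × V))) :
    ∑ᶠ A ∈ X, classSum G S A =
      ∑ κ : Equiv.Perm {x // x ∈ S} × ({x // x ∈ S} → V × V) with IsCatalyst G S κ.1 κ.2 ∧
        Multiset.map κ.2 (Finset.univ : Finset {x // x ∈ S}).val ∈ X,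
      (Equiv.Perm.sign κ.1 : ℤ) := by
  let ind (κ : Equiv.Perm {x // x ∈ S} × ({x // x ∈ S} → V × V)) : Multiset (V × V) :=
    Multiset.map κ.2 (Finset.univ : Finset {x // x ∈ S}).val
  let T : Finset (Multiset (V × V)) := (Finset.univ.image ind).filter (· ∈ X)
  rw [finsum_mem_eq_sum_of_subset (t := T)]
  · simp only [classSum]
    rw [Finset.sum_comm' (t' := Finset.univ.filter fun κ => IsCatalyst G S κ.1 κ.2 ∧ ind κ ∈ X)
      (s' := fun κ => {ind κ})]
    · simp only [Finset.sum_singleton]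
      rfl
    · intro A κ
      simp only [T, Finset.mem_filter, Finset.mem_image, Finset.mem_univ, true_and,
        Finset.mem_singleton]
      constructor
      · rintro ⟨⟨-, hA⟩, hc, hi⟩
        obtain rfl : ind κ = A := hi
        exact ⟨rfl, hc, hA⟩
      · rintro ⟨rfl, hc, hA⟩
        exact ⟨⟨⟨κ, rfl⟩, hA⟩, hc, rfl⟩
  · rintro A ⟨hA, hsupp⟩
    obtain ⟨κ, hκ, -⟩ := Finset.exists_ne_zero_of_sum_ne_zero hsupp
    simp only [Finset.mem_filter, Finset.mem_univ, true_and] at hκ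
    simp only [T, Finset.coe_filter, Finset.mem_image, Finset.mem_univ, true_and]
    exact ⟨⟨κ, hκ.2⟩, hA⟩
  · intro A hA
    exact (Finset.mem_filter.mp hA).2

end Forest

theorem composite_arrowflow_class_sum
    {V : Type*} [Fintype V] (G : SimpleGraph V) (hG : G.IsTree)
    (S : Finset V) (m : ℕ) (hm : S.card = m) (hm2 : 2 ≤ m)
    (F : SimpleGraph V) (hF : IsSStarRootedForest G F S) :
    ∑ᶠ A ∈ {A : Multiset (V × V) |
        IsArrowflow G m A ∧ IsComposite G S A ∧ missingForest G A = F},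
      classSum G S A =
      (-1) ^ m * 2 ^ (m - 2) * ((bdeg G F S : ℤ) - 1) * ((bdeg G F S : ℤ) - 4) := by
  subst hm
  obtain ⟨r, hr⟩ := hF.2.2.2.1
  rw [finsum_mem_classSum, ← sum_separating_bijections hG hF hr hm2,
    ← sum_catalyst_eq_sum_separating_bijections hG hF hr]
  simp only [Set.mem_ofPred_eq]
end

section
/- Let T be a finite tree, let S be a subset of its vertices of cardinality m ≥ 2, and let A be an m-arrowflow on T. Suppose i and j are distinct vertices of S lying in the same connected component of the missing forest M(A). Then for every S-catalyst (σ, f) inducing A, the pair (σ ∘ (i j), f ∘ (i j)) is again an S-catalyst inducing A, where (i j) denotes the transposition of i and j; moreover this map is an involution on C_S(A) and reverses the sign: sgn(σ ∘ (i j)) = − sgn(σ). -/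
open scoped Classical

/-- Deleting an edge that separates `x` from `y` shows that its endpoint `u` lies on every
geodesic from `x` to `y`. -/
theorem dist_eq_add_of_not_reachable_deleteEdges {V : Type*} {G : SimpleGraph V}
    (hG : G.Connected) {u v x y : V}
    (h : ¬ (G.deleteEdges {s(u, v)}).Reachable x y) :
    G.dist x y = G.dist x u + G.dist u y := by
  obtain ⟨p, hp⟩ := hG.exists_walk_length_eq_dist x y
  have huv : s(u, v) ∈ p.edges := by
    by_contra hne
    exact h (p.toDeleteEdge s(u, v) hne).reachable
  have hu : u ∈ p.support := p.fst_mem_support_of_mem_edges huv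
  have hlen := congrArg SimpleGraph.Walk.length (p.take_spec hu)
  rw [SimpleGraph.Walk.length_append] at hlen
  have h₁ := SimpleGraph.dist_le (p.takeUntil u hu)
  have h₂ := SimpleGraph.dist_le (p.dropUntil u hu)
  have h₃ := hG.dist_triangle (u := x) (v := u) (w := y)
  omega

/-- In a tree, the arc `(u, v)` lies on the path from `x` to `y` if and only if, once the edge
is deleted, `x` is on the side of `u` and `y` is on the side of `v`. -/
theorem dist_add_one_add_dist_eq_iff_s10 {V : Type*} {G : SimpleGraph V} (hG : G.IsTree)
    {u v : V} (huv : G.Adj u v) (x y : V) :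
    G.dist x u + 1 + G.dist v y = G.dist x y ↔
      (G.deleteEdges {s(u, v)}).Reachable x u ∧ (G.deleteEdges {s(u, v)}).Reachable v y := by
  have hc := hG.connected
  have hswap : G.deleteEdges {s(u, v)} = G.deleteEdges {s(v, u)} := by rw [Sym2.eq_swap]
  have huv1 : G.dist u v = 1 := SimpleGraph.dist_eq_one_iff_adj.mpr huv
  have hvu1 : G.dist v u = 1 := SimpleGraph.dist_eq_one_iff_adj.mpr huv.symm
  constructor
  · intro h
    constructor
    · by_contra hn
      rw [hswap] at hn
      have h₁ := dist_eq_add_of_not_reachable_deleteEdges hc hn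
      have h₂ := hc.dist_triangle (u := x) (v := v) (w := y)
      omega
    · by_contra hn
      have h₁ := dist_eq_add_of_not_reachable_deleteEdges hc hn
      have h₂ := hc.dist_triangle (u := x) (v := u) (w := y)
      omega
  · rintro ⟨hx, hy⟩
    have hbridge : ¬ (G.deleteEdges {s(u, v)}).Reachable u v :=
      SimpleGraph.isBridge_iff.mp
        (SimpleGraph.isAcyclic_iff_forall_adj_isBridge.mp hG.isAcyclic huv)
    have hxv : ¬ (G.deleteEdges {s(u, v)}).Reachable x v :=
      fun h => hbridge (hx.symm.trans h)
    have hxy : ¬ (G.deleteEdges {s(v, u)}).Reachable x y :=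
      hswap ▸ fun h => hxv (h.trans hy.symm)
    have h₁ := dist_eq_add_of_not_reachable_deleteEdges hc hxv
    have h₂ := dist_eq_add_of_not_reachable_deleteEdges hc hxy
    omega

theorem missingForest_le_deleteEdges {V : Type*} (G : SimpleGraph V) {A : Multiset (V × V)}
    {p : V × V} (hp : p ∈ A) : missingForest G A ≤ G.deleteEdges {s(p.1, p.2)} := by
  intro a b hab
  obtain ⟨hG, hA⟩ := (SimpleGraph.sdiff_adj _ _ _ _).mp hab
  refine SimpleGraph.deleteEdges_adj.mpr ⟨hG, fun h => hA ?_⟩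
  rw [arrowSG, SimpleGraph.fromRel_adj]
  refine ⟨hG.ne, ?_⟩
  rcases Sym2.eq_iff.mp (Set.mem_singleton_iff.mp h) with ⟨rfl, rfl⟩ | ⟨rfl, rfl⟩
  · exact Or.inl hp
  · exact Or.inr hp

/-- The source of a path in a tree may be moved within its component of the missing forest
without affecting which arcs of `A` lie on the path. -/
theorem dist_add_one_add_dist_eq_of_missingForest_reachable {V : Type*} {G : SimpleGraph V}
    (hG : G.IsTree) {A : Multiset (V × V)} {p : V × V} (hp : p ∈ A) (hadj : G.Adj p.1 p.2)
    {x x' y : V} (hx : (missingForest G A).Reachable x x')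
    (h : G.dist x p.1 + 1 + G.dist p.2 y = G.dist x y) :
    G.dist x' p.1 + 1 + G.dist p.2 y = G.dist x' y := by
  rw [dist_add_one_add_dist_eq_iff_s10 hG hadj] at h ⊢
  exact ⟨(hx.symm.mono (missingForest_le_deleteEdges G hp)).trans h.1, h.2⟩

theorem missing_path_involution
    {V : Type*} [Fintype V] (G : SimpleGraph V) (hG : G.IsTree)
    (S : Finset V) (m : ℕ) (hm : S.card = m) (hm2 : 2 ≤ m)
    (A : Multiset (V × V)) (hA : IsArrowflow G m A)
    (i j : V) (hi : i ∈ S) (hj : j ∈ S) (hij : i ≠ j)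
    (hreach : (missingForest G A).Reachable i j)
    (σ : Equiv.Perm {x // x ∈ S}) (f : {x // x ∈ S} → V × V)
    (hcat : IsCatalyst G S σ f) (hind : Induces S f A) :
    IsCatalyst G S (σ * Equiv.swap ⟨i, hi⟩ ⟨j, hj⟩)
        (f ∘ Equiv.swap ⟨i, hi⟩ ⟨j, hj⟩) ∧
      Induces S (f ∘ Equiv.swap ⟨i, hi⟩ ⟨j, hj⟩) A ∧
      (σ * Equiv.swap ⟨i, hi⟩ ⟨j, hj⟩) * Equiv.swap ⟨i, hi⟩ ⟨j, hj⟩ = σ ∧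
      (f ∘ Equiv.swap ⟨i, hi⟩ ⟨j, hj⟩) ∘ Equiv.swap ⟨i, hi⟩ ⟨j, hj⟩ = f ∧
      Equiv.Perm.sign (σ * Equiv.swap ⟨i, hi⟩ ⟨j, hj⟩) = - Equiv.Perm.sign σ := by
  set τ := Equiv.swap (⟨i, hi⟩ : {x // x ∈ S}) ⟨j, hj⟩ with hτ
  have hmem : ∀ k, f k ∈ A := fun k =>
    hind ▸ Multiset.mem_map_of_mem f (Finset.mem_univ_val k)
  have hreach_swap : ∀ k, (missingForest G A).Reachable (τ k).val k.val := by
    intro k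
    rw [hτ, Equiv.swap_apply_def]
    split_ifs with h₁ h₂
    · rw [h₁]
      exact hreach.symm
    · rw [h₂]
      exact hreach
    · exact SimpleGraph.Reachable.refl _
  refine ⟨fun k => ⟨(hcat (τ k)).1, ?_⟩, ?_, ?_, ?_, ?_⟩
  · exact dist_add_one_add_dist_eq_of_missingForest_reachable hG (hmem (τ k)) (hcat (τ k)).1
      (hreach_swap k) (hcat (τ k)).2
  · rw [Induces, ← hind, ← Multiset.map_map, Multiset.map_univ_val_equiv]
  · rw [mul_assoc, hτ, Equiv.swap_mul_self, mul_one]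
  · funext k
    simp [hτ]
  · rw [Equiv.Perm.sign_mul, hτ, Equiv.Perm.sign_swap (by simpa using hij), mul_neg, mul_one]
end

section
/- Let T be a finite tree, let S be a subset of its vertices of cardinality m, let F be an (S,*)-rooted spanning forest of T with floating component F_*, and let e be an edge of T adjacent to F_* (i.e., exactly one endpoint of e lies in F_*). Then the forest F ∪ {e} obtained by adding e to F is an S-rooted spanning forest of T. -/
open scoped Classical

/-- A vertex reachable from `a` after adding the edge `uv` is reachable from `a` either without
that edge, or by crossing it once. -/
theorem SimpleGraph.Reachable.of_sup_fromEdgeSet {V : Type*} {H : SimpleGraph V} {u v a b : V}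
    (h : (H ⊔ SimpleGraph.fromEdgeSet {s(u, v)}).Reachable a b) :
    H.Reachable a b ∨ (H.Reachable a u ∧ H.Reachable v b) ∨
      (H.Reachable a v ∧ H.Reachable u b) := by
  obtain ⟨p⟩ := h
  induction p with
  | nil => exact Or.inl (SimpleGraph.Reachable.refl _)
  | @cons x y z hxy _ ih =>
    rw [SimpleGraph.sup_adj, SimpleGraph.fromEdgeSet_adj, Set.mem_singleton_iff,
      Sym2.eq_iff] at hxy
    rcases hxy with hxy | ⟨⟨rfl, rfl⟩ | ⟨rfl, rfl⟩, -⟩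
    · rcases ih with h | ⟨h, h'⟩ | ⟨h, h'⟩
      · exact Or.inl (hxy.reachable.trans h)
      · exact Or.inr (Or.inl ⟨hxy.reachable.trans h, h'⟩)
      · exact Or.inr (Or.inr ⟨hxy.reachable.trans h, h'⟩)
    · rcases ih with h | ⟨_, h⟩ | ⟨_, h⟩
      · exact Or.inr (Or.inl ⟨SimpleGraph.Reachable.refl _, h⟩)
      · exact Or.inr (Or.inl ⟨SimpleGraph.Reachable.refl _, h⟩)
      · exact Or.inl h
    · rcases ih with h | ⟨_, h⟩ | ⟨_, h⟩
      · exact Or.inr (Or.inr ⟨SimpleGraph.Reachable.refl _, h⟩)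
      · exact Or.inl h
      · exact Or.inr (Or.inr ⟨SimpleGraph.Reachable.refl _, h⟩)

/-- Joining the floating component, at `u`, to a rooted component, at `v`, yields an `S`-rooted
forest. -/
theorem IsSStarRootedForest.sup_fromEdgeSet {V : Type*} {G F : SimpleGraph V} {S : Finset V}
    (hF : IsSStarRootedForest G F S) {u v : V} (he : G.Adj u v) (hu : u ∈ floatSet F S)
    (hv : v ∉ floatSet F S) :
    IsSRootedForest G (F ⊔ SimpleGraph.fromEdgeSet {s(u, v)}) S := by
  obtain ⟨hle, hac, hsep, -, hfl⟩ := hF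
  obtain ⟨r, hr, hrv⟩ : ∃ r ∈ S, F.Reachable r v := by
    simpa [floatSet] using hv
  have hF_le : F ≤ F ⊔ SimpleGraph.fromEdgeSet {s(u, v)} := le_sup_left
  have hvu : (F ⊔ SimpleGraph.fromEdgeSet {s(u, v)}).Adj v u := by
    simp [Sym2.eq_swap, he.ne']
  refine ⟨sup_le hle ?_, ?_, ?_, ?_⟩
  · rw [SimpleGraph.fromEdgeSet_le]
    exact Set.sdiff_subset.trans (Set.singleton_subset_iff.mpr he)
  · exact hac.sup_edge_of_not_reachable fun h => hu r hr (hrv.trans h.symm)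
  · intro s hs t ht hst
    rcases hst.of_sup_fromEdgeSet with h | ⟨h, -⟩ | ⟨-, h⟩
    · exact hsep s hs t ht h
    · exact absurd h (hu s hs)
    · exact absurd h.symm (hu t ht)
  · intro w
    by_cases hw : w ∈ floatSet F S
    · exact ⟨r, hr, ((hrv.mono hF_le).trans hvu.reachable).trans ((hfl u hu w hw).mono hF_le)⟩
    · obtain ⟨t, ht, htw⟩ : ∃ t ∈ S, F.Reachable t w := by
        simpa [floatSet] using hw
      exact ⟨t, ht, htw.mono hF_le⟩

theorem add_edge_of_SStarRooted
    {V : Type*} [Fintype V] (G : SimpleGraph V) (hG : G.IsTree)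
    (S : Finset V) (m : ℕ) (hm : S.card = m)
    (F : SimpleGraph V) (hF : IsSStarRootedForest G F S)
    (u v : V) (he : G.Adj u v)
    (hadj : (u ∈ floatSet F S ∧ v ∉ floatSet F S) ∨
      (u ∉ floatSet F S ∧ v ∈ floatSet F S)) :
    IsSRootedForest G (F ⊔ SimpleGraph.fromEdgeSet {s(u, v)}) S := by
  rcases hadj with ⟨hu, hv⟩ | ⟨hu, hv⟩
  · exact hF.sup_fromEdgeSet he hu hv
  · rw [Sym2.eq_swap]
    exact hF.sup_fromEdgeSet he.symm hv hu
end

section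
/- Let T be a finite tree on n vertices and let S be a subset of its vertices of cardinality m. Then (n − m) · |F_S(T)| = Σ_{F ∈ F_{S,*}(T)} bdeg(F_*), where F_S(T) is the set of S-rooted spanning forests of T, the sum is over all (S,*)-rooted spanning forests F of T, and F_* is the floating component of F. -/
open scoped Classical

namespace SimpleGraph

/-- If `H` has at most the edge `vw` besides the edges of `F`, then vertices joined in `H` are
joined in `F`, possibly after crossing `vw` once. -/
lemma Reachable.of_adj_or_eq {V : Type*} {F H : SimpleGraph V} {v w : V}
    (hFH : ∀ x y, H.Adj x y → F.Adj x y ∨ s(x, y) = s(v, w)) {a b : V} (h : H.Reachable a b) :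
    F.Reachable a b ∨ (F.Reachable a v ∧ F.Reachable w b) ∨
      (F.Reachable a w ∧ F.Reachable v b) := by
  obtain ⟨p⟩ := h
  induction p with
  | nil => exact .inl .rfl
  | @cons x y z hxy p ih =>
    rcases hFH x y hxy with hF | he
    · have := hF.reachable
      rcases ih with h | ⟨h, h'⟩ | ⟨h, h'⟩
      · exact .inl (this.trans h)
      · exact .inr (.inl ⟨this.trans h, h'⟩)
      · exact .inr (.inr ⟨this.trans h, h'⟩)
    · rcases Sym2.eq_iff.1 he with ⟨rfl, rfl⟩ | ⟨rfl, rfl⟩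
      · rcases ih with h | ⟨h, h'⟩ | ⟨h, h'⟩
        · exact .inr (.inl ⟨.rfl, h⟩)
        · exact .inr (.inl ⟨.rfl, h'⟩)
        · exact .inl h'
      · rcases ih with h | ⟨h, h'⟩ | ⟨h, h'⟩
        · exact .inr (.inr ⟨.rfl, h⟩)
        · exact .inl h'
        · exact .inr (.inr ⟨.rfl, h'⟩)

lemma adj_deleteEdges_or_eq {V : Type*} (H : SimpleGraph V) (v w : V) (x y : V)
    (h : H.Adj x y) : (H.deleteEdges {s(v, w)}).Adj x y ∨ s(x, y) = s(v, w) := by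
  simp only [deleteEdges_adj, Set.mem_singleton_iff]
  tauto

lemma sup_edge_adj_or_eq {V : Type*} (F : SimpleGraph V) (v w : V) (x y : V)
    (h : (F ⊔ edge v w).Adj x y) : F.Adj x y ∨ s(x, y) = s(v, w) := by
  rw [sup_adj, edge_adj] at h
  rw [Sym2.eq_iff]
  tauto

lemma deleteEdges_sup_edge {V : Type*} {F : SimpleGraph V} {v w : V} (h : ¬ F.Adj v w) :
    (F ⊔ edge v w).deleteEdges {s(v, w)} = F := by
  ext x y
  have hne : F.Adj x y → s(x, y) ≠ s(v, w) := fun hxy he ↦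
    h (by rwa [← mem_edgeSet, ← he, mem_edgeSet])
  simp only [deleteEdges_adj, Set.mem_singleton_iff]
  exact ⟨fun ⟨hxy, hn⟩ ↦ (sup_edge_adj_or_eq F v w x y hxy).resolve_right hn,
    fun hxy ↦ ⟨.inl hxy, hne hxy⟩⟩

lemma deleteEdges_sup_edge_of_adj {V : Type*} {H : SimpleGraph V} {v w : V} (h : H.Adj v w) :
    H.deleteEdges {s(v, w)} ⊔ edge v w = H := by
  ext x y
  have hxy : s(x, y) = s(v, w) → H.Adj x y := fun he ↦ by rwa [← mem_edgeSet, he, mem_edgeSet]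
  have hne : H.Adj x y → x ≠ y := fun h ↦ h.ne
  rw [Sym2.eq_iff] at hxy
  simp only [sup_adj, deleteEdges_adj, Set.mem_singleton_iff, Sym2.eq_iff, edge_adj]
  tauto

end SimpleGraph

open SimpleGraph

section

variable {V : Type*} {G F H : SimpleGraph V} {S : Finset V} {v w : V}

lemma notMem_floatSet : v ∉ floatSet F S ↔ ∃ s ∈ S, F.Reachable s v := by
  simp [floatSet]

lemma not_reachable_of_notMem_floatSet (hv : v ∉ floatSet F S) (hw : w ∈ floatSet F S) :
    ¬ F.Reachable v w := by
  obtain ⟨s, hs, hsv⟩ := notMem_floatSet.1 hv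
  exact fun h ↦ hw s hs (hsv.trans h)

/-- Deleting an edge of an `S`-rooted forest detaches the component of exactly one endpoint of
this edge from `S`. -/
lemma IsSRootedForest.exists_detached {a b : V} (hH : IsSRootedForest G H S) (hab : H.Adj a b) :
    ∃ v w, s(v, w) = s(a, b) ∧ v ∉ floatSet (H.deleteEdges {s(a, b)}) S ∧
      w ∈ floatSet (H.deleteEdges {s(a, b)}) S ∧
      ∀ x ∈ floatSet (H.deleteEdges {s(a, b)}) S,
        (H.deleteEdges {s(a, b)}).Reachable w x := by
  obtain ⟨-, hac, hinj, hsurj⟩ := hH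
  -- It is enough to treat the case where `v` is still attached to `S`.
  have key : ∀ v w s, s(v, w) = s(a, b) → s ∈ S →
      (H.deleteEdges {s(a, b)}).Reachable s v →
      w ∈ floatSet (H.deleteEdges {s(a, b)}) S ∧ ∀ x ∈ floatSet (H.deleteEdges {s(a, b)}) S,
        (H.deleteEdges {s(a, b)}).Reachable w x := by
    intro v w s he hs hsv
    rw [← he] at hsv ⊢
    have hvw : H.Adj v w := by rwa [← mem_edgeSet, he, mem_edgeSet]
    have hle : H.deleteEdges {s(v, w)} ≤ H := deleteEdges_le _
    have hbr : ¬ (H.deleteEdges {s(v, w)}).Reachable v w :=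
      isBridge_iff.1 (isAcyclic_iff_forall_adj_isBridge.1 hac hvw)
    have hwf : w ∈ floatSet (H.deleteEdges {s(v, w)}) S := by
      intro t ht htw
      obtain rfl := hinj s hs t ht
        (((hsv.mono hle).trans hvw.reachable).trans (htw.mono hle).symm)
      exact hbr (hsv.symm.trans htw)
    refine ⟨hwf, fun x hx ↦ ?_⟩
    obtain ⟨t, ht, htx⟩ := hsurj x
    rcases htx.of_adj_or_eq (H.adj_deleteEdges_or_eq v w) with h | ⟨-, h⟩ | ⟨h, -⟩
    · exact (hx t ht h).elim
    · exact h
    · exact (hwf t ht h).elim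
  obtain ⟨s, hs, hsa⟩ := hsurj a
  have hattached : (H.deleteEdges {s(a, b)}).Reachable s a ∨
      (H.deleteEdges {s(a, b)}).Reachable s b := by
    rcases hsa.of_adj_or_eq (H.adj_deleteEdges_or_eq a b) with h | ⟨h, -⟩ | ⟨h, -⟩
    exacts [.inl h, .inl h, .inr h]
  rcases hattached with h | h
  · exact ⟨a, b, rfl, notMem_floatSet.2 ⟨s, hs, h⟩, key a b s rfl hs h⟩
  · exact ⟨b, a, Sym2.eq_swap, notMem_floatSet.2 ⟨s, hs, h⟩, key b a s Sym2.eq_swap hs h⟩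

lemma IsSRootedForest.card_edgeFinset_add_card [Fintype V] (hH : IsSRootedForest G H S) :
    H.edgeFinset.card + S.card = Fintype.card V := by
  induction hn : H.edgeFinset.card generalizing H S with
  | zero =>
    have hbot : H = ⊥ := by simpa using hn
    have hS : S = Finset.univ := by
      refine Finset.eq_univ_of_forall fun v ↦ ?_
      obtain ⟨s, hs, hsv⟩ := hH.2.2.2 v
      rw [hbot, reachable_bot] at hsv
      exact hsv ▸ hs
    simp [hS]
  | succ n ih =>
    obtain ⟨e, he⟩ : H.edgeFinset.Nonempty := Finset.card_pos.1 (by omega)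
    induction e with | _ a b
    obtain ⟨v, w, -, -, hw, hfl⟩ := hH.exists_detached (mem_edgeFinset.1 he)
    have hle : H.deleteEdges {s(a, b)} ≤ H := deleteEdges_le _
    have hwS : w ∉ S := fun h ↦ hw w h .rfl
    have hcard : (H.deleteEdges {s(a, b)}).edgeFinset.card = n := by
      have : (H.deleteEdges {s(a, b)}).edgeFinset = H.edgeFinset.erase s(a, b) := by
        ext e
        simp [edgeSet_deleteEdges, and_comm]
      rw [this, Finset.card_erase_of_mem he, hn, Nat.add_sub_cancel]
    have hroot : IsSRootedForest G (H.deleteEdges {s(a, b)}) (insert w S) := by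
      refine ⟨hle.trans hH.1, hH.2.1.anti hle, ?_, fun x ↦ ?_⟩
      · intro s hs t ht hst
        rcases Finset.mem_insert.1 hs with rfl | hs' <;>
          rcases Finset.mem_insert.1 ht with rfl | ht'
        · rfl
        · exact (hw t ht' hst.symm).elim
        · exact (hw s hs' hst).elim
        · exact hH.2.2.1 s hs' t ht' (hst.mono hle)
      · by_cases hx : x ∈ floatSet (H.deleteEdges {s(a, b)}) S
        · exact ⟨w, Finset.mem_insert_self _ _, hfl x hx⟩
        · obtain ⟨s, hs, hsx⟩ := notMem_floatSet.1 hx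
          exact ⟨s, Finset.mem_insert_of_mem hs, hsx⟩
    have := ih hroot (by convert hcard)
    rw [Finset.card_insert_of_notMem hwS] at this
    omega

lemma IsSRootedForest.isSStarRootedForest_deleteEdges {a b : V} (hH : IsSRootedForest G H S)
    (hab : H.Adj a b) : IsSStarRootedForest G (H.deleteEdges {s(a, b)}) S := by
  obtain ⟨v, w, -, -, hw, hfl⟩ := hH.exists_detached hab
  have hle : H.deleteEdges {s(a, b)} ≤ H := deleteEdges_le _
  exact ⟨hle.trans hH.1, hH.2.1.anti hle, fun s hs t ht h ↦ hH.2.2.1 s hs t ht (h.mono hle),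
    ⟨w, hw⟩, fun x hx y hy ↦ (hfl x hx).symm.trans (hfl y hy)⟩

lemma IsSStarRootedForest.isSRootedForest_sup_edge (hF : IsSStarRootedForest G F S)
    (hv : v ∉ floatSet F S) (hw : w ∈ floatSet F S) (hvw : G.Adj v w) :
    IsSRootedForest G (F ⊔ edge v w) S := by
  obtain ⟨hle, hac, hinj, -, hconn⟩ := hF
  have hnr := not_reachable_of_notMem_floatSet hv hw
  have hle' : F ≤ F ⊔ edge v w := le_sup_left
  refine ⟨sup_le hle ((edge_le_iff G).2 (.inr hvw)), hac.sup_edge_of_not_reachable hnr, ?_, ?_⟩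
  · intro s hs t ht hst
    rcases hst.of_adj_or_eq (F.sup_edge_adj_or_eq v w) with h | ⟨-, h⟩ | ⟨h, -⟩
    · exact hinj s hs t ht h
    · exact (hw t ht h.symm).elim
    · exact (hw s hs h).elim
  · intro x
    by_cases hx : x ∈ floatSet F S
    · obtain ⟨s, hs, hsv⟩ := notMem_floatSet.1 hv
      have hadj : (F ⊔ edge v w).Adj v w := by simp [edge_adj, hvw.ne]
      exact ⟨s, hs, ((hsv.mono hle').trans hadj.reachable).trans ((hconn w hw x hx).mono hle')⟩
    · obtain ⟨s, hs, hsx⟩ := notMem_floatSet.1 hx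
      exact ⟨s, hs, hsx.mono hle'⟩

/-- In an acyclic graph, a vertex outside the floating component has at most one neighbour
in it. -/
lemma IsSStarRootedForest.eq_of_adj {w' : V} (hG : G.IsAcyclic) (hF : IsSStarRootedForest G F S)
    (hv : v ∉ floatSet F S) (hw : w ∈ floatSet F S) (hw' : w' ∈ floatSet F S)
    (hvw : G.Adj v w) (hvw' : G.Adj v w') : w = w' := by
  by_contra hne
  have hnr := not_reachable_of_notMem_floatSet hv hw
  refine isBridge_iff.1 (isAcyclic_iff_forall_adj_isBridge.1 hG hvw) ?_
  have hle : F ≤ G.deleteEdges {s(v, w)} := by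
    intro x y hxy
    refine deleteEdges_adj.2 ⟨hF.1 hxy, fun he ↦ hnr (Adj.reachable ?_)⟩
    rwa [← mem_edgeSet, ← Set.mem_singleton_iff.1 he, mem_edgeSet]
  have hadj : (G.deleteEdges {s(v, w)}).Adj v w' := by
    refine deleteEdges_adj.2 ⟨hvw', fun he ↦ hne ?_⟩
    exact (Sym2.congr_right.1 (Set.mem_singleton_iff.1 he)).symm
  exact hadj.reachable.trans ((hF.2.2.2.2 w' hw' w hw).mono hle)

/-- The edges of `G` leaving the floating set of `F`, as pairs whose second entry lies in the
floating set. -/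
noncomputable def boundaryPairs [Fintype V] (G F : SimpleGraph V) (S : Finset V) :
    Finset (V × V) :=
  Finset.univ.filter fun p ↦ p.1 ∉ floatSet F S ∧ p.2 ∈ floatSet F S ∧ G.Adj p.1 p.2

lemma mem_boundaryPairs [Fintype V] {p : V × V} :
    p ∈ boundaryPairs G F S ↔ p.1 ∉ floatSet F S ∧ p.2 ∈ floatSet F S ∧ G.Adj p.1 p.2 := by
  simp [boundaryPairs]

lemma IsSStarRootedForest.bdeg_eq_card [Fintype V] (hG : G.IsAcyclic)
    (hF : IsSStarRootedForest G F S) : bdeg G F S = (boundaryPairs G F S).card := by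
  have himage : {v | v ∉ floatSet F S ∧ ∃ w ∈ floatSet F S, G.Adj v w} =
      ((boundaryPairs G F S).image Prod.fst : Set V) := by
    ext v
    simp [mem_boundaryPairs]
  rw [bdeg, himage, Set.ncard_coe_finset, Finset.card_image_of_injOn]
  rintro ⟨v, w⟩ hp ⟨v', w'⟩ hp' (rfl : v = v')
  obtain ⟨hv, hw, hvw⟩ := mem_boundaryPairs.1 hp
  obtain ⟨-, hw', hvw'⟩ := mem_boundaryPairs.1 hp'
  exact Prod.ext rfl (hF.eq_of_adj hG hv hw hw' hvw hvw')

end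

theorem sum_of_boundary_degrees
    {V : Type*} [Fintype V] (G : SimpleGraph V) (hG : G.IsTree)
    (S : Finset V) (m : ℕ) (hm : S.card = m) :
    (Fintype.card V - m) *
        (Finset.univ.filter (fun H : SimpleGraph V => IsSRootedForest G H S)).card =
      ∑ H ∈ Finset.univ.filter (fun H : SimpleGraph V => IsSStarRootedForest G H S),
        bdeg G H S := by
  have hleft : (Fintype.card V - m) *
      (Finset.univ.filter (fun H : SimpleGraph V => IsSRootedForest G H S)).card =
      ((Finset.univ.filter (fun H : SimpleGraph V => IsSRootedForest G H S)).sigma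
        fun H ↦ H.edgeFinset).card := by
    rw [Finset.card_sigma, Finset.sum_const_nat (m := Fintype.card V - m), mul_comm]
    intro H hH
    have := (Finset.mem_filter.1 hH).2.card_edgeFinset_add_card
    omega
  have hright : ∑ F ∈ Finset.univ.filter (fun F : SimpleGraph V => IsSStarRootedForest G F S),
      bdeg G F S =
      ((Finset.univ.filter (fun F : SimpleGraph V => IsSStarRootedForest G F S)).sigma
        fun F ↦ boundaryPairs G F S).card := by
    rw [Finset.card_sigma]
    exact Finset.sum_congr rfl fun F hF ↦ (Finset.mem_filter.1 hF).2.bdeg_eq_card hG.isAcyclic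
  rw [hleft, hright]
  symm
  refine Finset.card_bij (fun x _ ↦ ⟨x.1 ⊔ edge x.2.1 x.2.2, s(x.2.1, x.2.2)⟩) ?_ ?_ ?_
  · rintro ⟨F, v, w⟩ hx
    simp only [Finset.mem_sigma, Finset.mem_filter, Finset.mem_univ, true_and,
      mem_boundaryPairs] at hx
    obtain ⟨hF, hv, hw, hvw⟩ := hx
    simp only [Finset.mem_sigma, Finset.mem_filter, Finset.mem_univ, true_and, mem_edgeFinset,
      mem_edgeSet]
    exact ⟨hF.isSRootedForest_sup_edge hv hw hvw, by simp [edge_adj, hvw.ne]⟩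
  · rintro ⟨F, v, w⟩ hx ⟨F', v', w'⟩ hx' h
    simp only [Finset.mem_sigma, Finset.mem_filter, Finset.mem_univ, true_and,
      mem_boundaryPairs] at hx hx'
    obtain ⟨-, hv, hw, -⟩ := hx
    obtain ⟨-, hv', hw', -⟩ := hx'
    simp only [Sigma.mk.injEq, heq_eq_eq] at h
    obtain ⟨hsup, he⟩ := h
    have hFF' : F = F' := by
      rw [← deleteEdges_sup_edge fun h ↦ not_reachable_of_notMem_floatSet hv hw h.reachable,
        ← deleteEdges_sup_edge fun h ↦ not_reachable_of_notMem_floatSet hv' hw' h.reachable,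
        hsup, he]
    subst hFF'
    rcases Sym2.eq_iff.1 he with ⟨rfl, rfl⟩ | ⟨rfl, rfl⟩
    · rfl
    · exact (hv hw').elim
  · rintro ⟨H, e⟩ hx
    induction e with | _ a b
    simp only [Finset.mem_sigma, Finset.mem_filter, Finset.mem_univ, true_and, mem_edgeFinset,
      mem_edgeSet] at hx
    obtain ⟨hH, hab⟩ := hx
    obtain ⟨v, w, he, hv, hw, -⟩ := hH.exists_detached hab
    have hvw : H.Adj v w := by rwa [← mem_edgeSet, he, mem_edgeSet]
    refine ⟨⟨H.deleteEdges {s(a, b)}, v, w⟩, ?_, ?_⟩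
    · simp only [Finset.mem_sigma, Finset.mem_filter, Finset.mem_univ, true_and,
        mem_boundaryPairs]
      exact ⟨hH.isSStarRootedForest_deleteEdges hab, hv, hw, hH.1 hvw⟩
    · simp only [← he, deleteEdges_sup_edge_of_adj hvw]
end
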